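/- arXiv:2109.01308 — 6 statements merged into one kernel-verified Lean document; each statement's English description precedes it below -/
import Mathlib

section
/- Let m ≥ 2 experts forecast an event with n ≥ 2 outcomes, and let α be a real number with α < 0 or α ≥ 2(m−1)²n. Then the contract function Π^α defined by Π^α_i(P; j) = s_qu(p_i; j) − (m−1)² s_qu(p̄_{−i}; j) + α p̄_{−i,j} is strictly proper and arbitrage-free. -/
open Finset

/-- Brier's quadratic scoring rule: `s_qu(p; j) = 1 - (1 - p j)^2 - ∑_{l ≠ j} (p l)^2`. -/
noncomputable def squ {n : ℕ} (p : Fin n → ℝ) (j : Fin n) : ℝ :=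
  1 - (1 - p j) ^ 2 - ∑ l ∈ ({j}ᶜ : Finset (Fin n)), (p l) ^ 2

/-- The average report `p̄_{-i}` of all experts except `i`. -/
noncomputable def avgExcept {m n : ℕ} (P : Fin m → Fin n → ℝ) (i : Fin m) : Fin n → ℝ :=
  fun j => (1 / ((m : ℝ) - 1)) * ∑ k ∈ ({i}ᶜ : Finset (Fin m)), P k j

/-- The contract function `Π^α_i(P; j) = s_qu(p_i; j) - (m-1)^2 s_qu(p̄_{-i}; j) + α p̄_{-i,j}`. -/
noncomputable def piAlpha {m n : ℕ} (α : ℝ) (P : Fin m → Fin n → ℝ) (i : Fin m) (j : Fin n) : ℝ :=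
  squ (P i) j - ((m : ℝ) - 1) ^ 2 * squ (avgExcept P i) j + α * avgExcept P i j

/-- A tuple of reports, one probability distribution in the simplex `Δ_n` per expert. -/
def IsSimplexTuple {m n : ℕ} (P : Fin m → Fin n → ℝ) : Prop :=
  ∀ k, P k ∈ stdSimplex ℝ (Fin n)

/-- A contract function is strictly proper if, for every expert `i`, belief `b ∈ Δ_n`, and
fixed reports of the other experts, the expected reward `∑ j, b j * Π_i(x, p_{-i}; j)` is
uniquely maximized over `x ∈ Δ_n` at `x = b`. -/
def StrictlyProper {m n : ℕ} (Φ : (Fin m → Fin n → ℝ) → Fin m → Fin n → ℝ) : Prop :=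
  ∀ (i : Fin m) (P : Fin m → Fin n → ℝ), IsSimplexTuple P →
    ∀ b ∈ stdSimplex ℝ (Fin n), ∀ x ∈ stdSimplex ℝ (Fin n), x ≠ b →
      ∑ j, b j * Φ (Function.update P i x) i j < ∑ j, b j * Φ (Function.update P i b) i j

/-- `Φ` admits arbitrage by the coalition `C`: there are report tuples `P, Q` agreeing
outside `C` such that the coalition's total reward under `Q` is at least that under `P`
for every outcome, and strictly larger for some outcome. -/
def AdmitsArbitrageBy {m n : ℕ} (Φ : (Fin m → Fin n → ℝ) → Fin m → Fin n → ℝ)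
    (C : Finset (Fin m)) : Prop :=
  ∃ P Q : Fin m → Fin n → ℝ, IsSimplexTuple P ∧ IsSimplexTuple Q ∧
    (∀ i ∉ C, P i = Q i) ∧
    (∀ j, ∑ i ∈ C, Φ P i j ≤ ∑ i ∈ C, Φ Q i j) ∧
    (∃ j, ∑ i ∈ C, Φ P i j < ∑ i ∈ C, Φ Q i j)

/-- `Φ` admits arbitrage if some coalition admits arbitrage. -/
def AdmitsArbitrage {m n : ℕ} (Φ : (Fin m → Fin n → ℝ) → Fin m → Fin n → ℝ) : Prop :=
  ∃ C : Finset (Fin m), AdmitsArbitrageBy Φ C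

/-- `Φ` is arbitrage-free if it admits no arbitrage. -/
def ArbitrageFree {m n : ℕ} (Φ : (Fin m → Fin n → ℝ) → Fin m → Fin n → ℝ) : Prop :=
  ¬ AdmitsArbitrage Φ

theorem squ_eq {n : ℕ} (p : Fin n → ℝ) (j : Fin n) :
    squ p j = 2 * p j - ∑ l, p l ^ 2 := by
  unfold squ
  rw [← Finset.sum_add_sum_compl ({j} : Finset (Fin n)) (fun l => p l ^ 2), Finset.sum_singleton]
  ring

theorem avgExcept_update {m n : ℕ} (P : Fin m → Fin n → ℝ) (i : Fin m) (x : Fin n → ℝ) :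
    avgExcept (Function.update P i x) i = avgExcept P i := by
  funext j
  unfold avgExcept
  congr 1
  refine Finset.sum_congr rfl fun k hk => ?_
  rw [Function.update_of_ne (by simpa using hk)]

/-- The expected Brier score under the belief `b` is uniquely maximized by reporting `b`. -/
theorem sum_mul_squ_lt {n : ℕ} {b x : Fin n → ℝ} (hb : ∑ j, b j = 1) (hxb : x ≠ b) :
    ∑ j, b j * squ x j < ∑ j, b j * squ b j := by
  obtain ⟨k, hk⟩ := Function.ne_iff.mp hxb
  have hpos : 0 < ∑ j, (x j - b j) ^ 2 :=
    Finset.sum_pos' (fun j _ => sq_nonneg _)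
      ⟨k, Finset.mem_univ k, by have := sub_ne_zero.mpr hk; positivity⟩
  have hexp (y : Fin n → ℝ) : ∑ j, b j * squ y j = 2 * ∑ j, b j * y j - ∑ j, y j ^ 2 := by
    simp_rw [squ_eq, mul_sub, Finset.sum_sub_distrib, ← Finset.sum_mul, hb, one_mul,
      Finset.mul_sum]
    congr 1
    exact Finset.sum_congr rfl fun j _ => by ring
  have hsq : ∑ j, (x j - b j) ^ 2 = ∑ j, x j ^ 2 - 2 * ∑ j, b j * x j + ∑ j, b j * b j := by
    rw [Finset.mul_sum, ← Finset.sum_sub_distrib, ← Finset.sum_add_distrib]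
    exact Finset.sum_congr rfl fun j _ => by ring
  have hbb : ∑ j, b j ^ 2 = ∑ j, b j * b j := Finset.sum_congr rfl fun j _ => by ring
  rw [hexp, hexp, hbb]
  linarith

theorem strictlyProper_piAlpha (m n : ℕ) (α : ℝ) :
    StrictlyProper (piAlpha (m := m) (n := n) α) := by
  intro i P _ b hb x _ hxb
  have hsplit (y : Fin n → ℝ) : ∑ j, b j * piAlpha α (Function.update P i y) i j
      = ∑ j, b j * squ y j + ∑ j, b j * (α * avgExcept P i j
        - ((m : ℝ) - 1) ^ 2 * squ (avgExcept P i) j) := by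
    rw [← Finset.sum_add_distrib]
    refine Finset.sum_congr rfl fun j _ => ?_
    unfold piAlpha
    rw [avgExcept_update, Function.update_self]
    ring
  rw [hsplit, hsplit]
  linarith [sum_mul_squ_lt hb.2 hxb]

/-- The quadratic terms of expert `i`'s own report cancel, leaving a reward affine in `P i`
once the total report is known. -/
theorem piAlpha_eq {m n : ℕ} (hm : 2 ≤ m) (α : ℝ) (P : Fin m → Fin n → ℝ) (i : Fin m)
    (j : Fin n) :
    piAlpha α P i j
      = (2 - (α / ((m : ℝ) - 1) - 2 * ((m : ℝ) - 1))) * P i j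
        + (α / ((m : ℝ) - 1) - 2 * ((m : ℝ) - 1)) * ∑ k, P k j
        + ∑ l, (∑ k, P k l) ^ 2 - 2 * ∑ l, (∑ k, P k l) * P i l := by
  have hm' : (2 : ℝ) ≤ m := by exact_mod_cast hm
  have hN : (m : ℝ) - 1 ≠ 0 := by linarith
  have havg (l : Fin n) : avgExcept P i l = (1 / ((m : ℝ) - 1)) * (∑ k, P k l - P i l) := by
    unfold avgExcept
    rw [← Finset.sum_add_sum_compl ({i} : Finset (Fin m)) (fun k => P k l), Finset.sum_singleton,
      add_sub_cancel_left]
  have hsq : ((m : ℝ) - 1) ^ 2 * ∑ l, avgExcept P i l ^ 2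
      = ∑ l, (∑ k, P k l) ^ 2 - 2 * ∑ l, (∑ k, P k l) * P i l + ∑ l, P i l ^ 2 := by
    rw [Finset.mul_sum, Finset.mul_sum, ← Finset.sum_sub_distrib, ← Finset.sum_add_distrib]
    refine Finset.sum_congr rfl fun l _ => ?_
    rw [havg]
    field_simp
    ring
  unfold piAlpha
  rw [squ_eq, squ_eq, mul_sub, hsq, havg]
  field_simp
  ring

/-- A coalition's reward depends on its members' reports only through their sum. -/
theorem sum_piAlpha_eq {m n : ℕ} (hm : 2 ≤ m) (α : ℝ) (P : Fin m → Fin n → ℝ)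
    (C : Finset (Fin m)) (j : Fin n) :
    ∑ i ∈ C, piAlpha α P i j
      = (2 - (α / ((m : ℝ) - 1) - 2 * ((m : ℝ) - 1))) * ∑ i ∈ C, P i j
        + #C * ((α / ((m : ℝ) - 1) - 2 * ((m : ℝ) - 1)) * ∑ k, P k j + ∑ l, (∑ k, P k l) ^ 2)
        - 2 * ∑ l, (∑ k, P k l) * ∑ i ∈ C, P i l := by
  simp_rw [piAlpha_eq hm, Finset.sum_sub_distrib, Finset.sum_add_distrib, ← Finset.mul_sum,
    Finset.sum_const, nsmul_eq_mul]
  rw [Finset.sum_comm]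
  simp_rw [← Finset.mul_sum]
  ring

/-- A change `κ * D j + E`, where `D` sums to zero and `E = ∑ l, W l * D l` is positive for a
nonnegative `W`, is negative somewhere: weight the indices by `W`, or by `∑ W - W`. -/
theorem not_all_nonneg_of_pos {n : ℕ} {W D : Fin n → ℝ} {κ E : ℝ} (hW : ∀ j, 0 ≤ W j)
    (hE : E = ∑ l, W l * D l) (hEpos : 0 < E) (hD : ∑ j, D j = 0)
    (hκ : κ + ∑ j, W j < 0 ∨ ((n : ℝ) - 1) * ∑ j, W j < κ) :
    ¬ ∀ j, 0 ≤ κ * D j + E := by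
  intro h
  have hw : ∑ j, W j * (κ * D j + E) = E * (κ + ∑ j, W j) := by
    simp_rw [mul_add, Finset.sum_add_distrib, ← Finset.sum_mul, mul_left_comm _ κ,
      ← Finset.mul_sum, ← hE]
    ring
  rcases hκ with hκ | hκ
  · have := Finset.sum_nonneg fun j (_ : j ∈ Finset.univ) => mul_nonneg (hW j) (h j)
    rw [hw] at this
    linarith [mul_neg_of_pos_of_neg hEpos hκ]
  · have hle (j : Fin n) : W j ≤ ∑ l, W l :=
      Finset.single_le_sum (fun l _ => hW l) (Finset.mem_univ j)
    have := Finset.sum_nonneg fun j (_ : j ∈ Finset.univ) =>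
      mul_nonneg (sub_nonneg.mpr (hle j)) (h j)
    simp_rw [sub_mul, Finset.sum_sub_distrib, hw, ← Finset.mul_sum, Finset.sum_add_distrib,
      ← Finset.mul_sum, hD] at this
    simp only [Finset.sum_const, Finset.card_univ, Fintype.card_fin, nsmul_eq_mul] at this
    nlinarith [mul_pos hEpos (sub_pos.mpr hκ)]

theorem arbitrageFree_piAlpha (m n : ℕ) (hm : 2 ≤ m) (α : ℝ)
    (hα : α < 0 ∨ 2 * ((m : ℝ) - 1) ^ 2 * (n : ℝ) ≤ α) :
    ArbitrageFree (piAlpha (m := m) (n := n) α) := by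
  rintro ⟨C, P, Q, hP, hQ, hPQ, hle, j₀, hlt⟩
  have hm' : (2 : ℝ) ≤ m := by exact_mod_cast hm
  have hN : 0 < (m : ℝ) - 1 := by linarith
  have hn : 1 ≤ (n : ℝ) := by exact_mod_cast j₀.pos
  simp_rw [sum_piAlpha_eq hm] at hle hlt
  obtain ⟨β, hβ⟩ : ∃ β, β = α / ((m : ℝ) - 1) - 2 * ((m : ℝ) - 1) := ⟨_, rfl⟩
  obtain ⟨U, hU⟩ : ∃ U : Fin n → ℝ, U = fun l => ∑ i ∈ C, P i l := ⟨_, rfl⟩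
  obtain ⟨V, hV⟩ : ∃ V : Fin n → ℝ, V = fun l => ∑ i ∈ C, Q i l := ⟨_, rfl⟩
  obtain ⟨R, hR⟩ : ∃ R : Fin n → ℝ, R = fun l => ∑ i ∈ Cᶜ, P i l := ⟨_, rfl⟩
  have hPU (l : Fin n) : ∑ i ∈ C, P i l = U l := by rw [hU]
  have hQV (l : Fin n) : ∑ i ∈ C, Q i l = V l := by rw [hV]
  have hPS (l : Fin n) : ∑ i, P i l = U l + R l := by
    rw [hU, hR, Finset.sum_add_sum_compl]
  have hQS (l : Fin n) : ∑ i, Q i l = V l + R l := by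
    rw [hV, hR, ← Finset.sum_add_sum_compl C]
    congr 1
    exact Finset.sum_congr rfl fun i hi => by rw [hPQ i (by simpa using hi)]
  simp_rw [hPU, hQV, hPS, hQS, ← hβ] at hle hlt
  have hU0 (l : Fin n) : 0 ≤ U l := by rw [hU]; exact Finset.sum_nonneg fun i _ => (hP i).1 l
  have hV0 (l : Fin n) : 0 ≤ V l := by rw [hV]; exact Finset.sum_nonneg fun i _ => (hQ i).1 l
  have hR0 (l : Fin n) : 0 ≤ R l := by rw [hR]; exact Finset.sum_nonneg fun i _ => (hP i).1 l
  have hUs : ∑ l, U l = #C := by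
    rw [hU, Finset.sum_comm]; simp [fun i => (hP i).2]
  have hVs : ∑ l, V l = #C := by
    rw [hV, Finset.sum_comm]; simp [fun i => (hQ i).2]
  have hRs : ∑ l, R l = m - #C := by
    have := Finset.sum_congr rfl fun l (_ : l ∈ Finset.univ) => hPS l
    rw [Finset.sum_add_distrib, hUs, Finset.sum_comm] at this
    simp only [fun i => (hP i).2, Finset.sum_const, Finset.card_univ, Fintype.card_fin,
      nsmul_eq_mul, mul_one] at this
    linarith
  obtain ⟨c, hc⟩ : ∃ c : ℝ, c = #C := ⟨_, rfl⟩
  rw [← hc] at hUs hVs hRs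
  simp_rw [← hc] at hle hlt
  have hDs : ∑ j, (V j - U j) = 0 := by rw [Finset.sum_sub_distrib, hUs, hVs, sub_self]
  obtain ⟨W, hW⟩ : ∃ W : Fin n → ℝ, W = fun l => (c - 2) * (U l + V l) + 2 * (c - 1) * R l :=
    ⟨_, rfl⟩
  obtain ⟨E, hE⟩ : ∃ E, E = ∑ l, W l * (V l - U l) := ⟨_, rfl⟩
  have hEexp : E = (c * ∑ l, (V l + R l) ^ 2 - 2 * ∑ l, (V l + R l) * V l)
      - (c * ∑ l, (U l + R l) ^ 2 - 2 * ∑ l, (U l + R l) * U l) := by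
    rw [hE, hW]
    simp_rw [Finset.mul_sum, ← Finset.sum_sub_distrib]
    exact Finset.sum_congr rfl fun l _ => by ring
  have hnonneg (j : Fin n) : 0 ≤ (2 + β * (c - 1)) * (V j - U j) + E := by
    linarith [hle j]
  have hpos : 0 < (2 + β * (c - 1)) * (V j₀ - U j₀) + E := by linarith
  have hEpos : 0 < E := by
    have := Finset.sum_pos' (fun j _ => hnonneg j) ⟨j₀, Finset.mem_univ j₀, hpos⟩
    rw [Finset.sum_add_distrib, ← Finset.mul_sum, hDs, mul_zero, zero_add] at this
    simp only [Finset.sum_const, Finset.card_univ, Fintype.card_fin, nsmul_eq_mul] at this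
    exact pos_of_mul_pos_right this (by positivity)
  have hcard : #C = 0 ∨ #C = 1 ∨ 2 ≤ #C := by omega
  rcases hcard with h0 | h1 | h2
  · have hC := Finset.card_eq_zero.mp h0
    simp [hE, hU, hV, hC] at hEpos
  · have hc1 : c = 1 := by rw [hc, h1, Nat.cast_one]
    have hw := Finset.sum_nonneg fun j (_ : j ∈ Finset.univ) => mul_nonneg (hU0 j) (hnonneg j)
    have heq : ∑ j, U j * ((2 + β * (c - 1)) * (V j - U j) + E)
        = - ∑ j, (V j - U j) ^ 2 := by
      simp_rw [mul_add, Finset.sum_add_distrib, ← Finset.sum_mul]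
      rw [hUs, hE, hW, hc1, one_mul, ← Finset.sum_add_distrib, ← Finset.sum_neg_distrib]
      exact Finset.sum_congr rfl fun l _ => by ring
    have hzero : ∑ j, (V j - U j) ^ 2 = 0 :=
      le_antisymm (by linarith) (Finset.sum_nonneg fun j _ => sq_nonneg _)
    rw [Finset.sum_eq_zero_iff_of_nonneg fun j _ => sq_nonneg _] at hzero
    refine hEpos.ne' (hE.trans (Finset.sum_eq_zero fun j hj => ?_))
    rw [pow_eq_zero_iff two_ne_zero |>.mp (hzero j hj), mul_zero]
  · have hc2 : 2 ≤ c := by rw [hc]; exact_mod_cast h2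
    have hW0 (j : Fin n) : 0 ≤ W j := by
      rw [hW]
      exact add_nonneg (mul_nonneg (by linarith) (add_nonneg (hU0 j) (hV0 j)))
        (mul_nonneg (by linarith) (hR0 j))
    have hWs : ∑ j, W j = 2 * (c - 1) * ((m : ℝ) - 1) - 2 := by
      rw [hW, Finset.sum_add_distrib, ← Finset.mul_sum, ← Finset.mul_sum,
        Finset.sum_add_distrib, hUs, hVs, hRs]
      ring
    refine not_all_nonneg_of_pos hW0 hE hEpos hDs ?_ hnonneg
    rw [hWs, hβ]
    rcases hα with hα | hα
    · left
      nlinarith [mul_neg_of_neg_of_pos (div_neg_of_neg_of_pos hα hN)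
        (show 0 < c - 1 by linarith)]
    · right
      have hα' : 2 * ((m : ℝ) - 1) * n ≤ α / ((m : ℝ) - 1) := by
        rw [le_div_iff₀ hN]
        linarith
      nlinarith [mul_le_mul_of_nonneg_right hα' (show 0 ≤ c - 1 by linarith)]

/-- **Theorem 1 (main theorem).** For `m ≥ 2` experts, `n ≥ 2` outcomes, and `α < 0` or
`α ≥ 2(m-1)²n`, the contract function `Π^α` is strictly proper and arbitrage-free. -/
theorem piAlpha_strictlyProper_arbitrageFree (m n : ℕ) (hm : 2 ≤ m) (hn : 2 ≤ n) (α : ℝ)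
    (hα : α < 0 ∨ 2 * ((m : ℝ) - 1) ^ 2 * (n : ℝ) ≤ α) :
    StrictlyProper (piAlpha (m := m) (n := n) α) ∧
      ArbitrageFree (piAlpha (m := m) (n := n) α) := by
  exact ⟨strictlyProper_piAlpha m n α, arbitrageFree_piAlpha m n hm α hα⟩
end

section
/- Let m ≥ 2, n = 2, α ∈ ℝ, and set d = m − 1 − α/(4(m−1)). Then there exists a real constant f(m, α), depending only on m and α, such that for all reports P ∈ (Δ_2)^m, all experts i ∈ [m], and all outcomes j ∈ {1,2}: s_qu(p_i; j) − (m−1)² s_qu(p̄_{−i}; j) + α p̄_{−i,j} = 2(p_{[m],j} − d − 1)(p_{[m],j} − 2p_{i,j} − d + 1) + f(m, α), where p_{[m],j} = Σ_{i∈[m]} p_{i,j}. -/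
open Finset

/-- With two outcomes the quadratic score depends only on the probability of the outcome. -/
lemma squ_two_outcomes {p : Fin 2 → ℝ} (hp : ∑ l, p l = 1) (j : Fin 2) :
    squ p j = 1 - 2 * (1 - p j) ^ 2 := by
  have hsum : p j + ∑ l ∈ ({j}ᶜ : Finset (Fin 2)), p l = 1 := by
    rw [← hp, Fintype.sum_eq_add_sum_compl j]
  have hcompl : ({j}ᶜ : Finset (Fin 2)) = {1 - j} := by
    fin_cases j <;> decide
  rw [hcompl, sum_singleton] at hsum
  rw [squ, hcompl, sum_singleton, eq_sub_of_add_eq' hsum]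
  ring

/-- The average of the other experts' reports has total mass one. -/
lemma sum_avgExcept {m n : ℕ} (hm : 2 ≤ m) {P : Fin m → Fin n → ℝ} (hP : IsSimplexTuple P)
    (i : Fin m) : ∑ j, avgExcept P i j = 1 := by
  have hm' : (m : ℝ) - 1 ≠ 0 := by
    have : (2 : ℝ) ≤ m := by exact_mod_cast hm
    linarith
  have hcard : ∑ k ∈ ({i}ᶜ : Finset (Fin m)), ∑ j, P k j = (m : ℝ) - 1 := by
    rw [sum_congr rfl fun k _ => (hP k).2]
    simp [card_compl, Nat.cast_sub (show 1 ≤ m by omega)]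
  simp only [avgExcept]
  rw [← mul_sum, sum_comm, hcard, one_div_mul_cancel hm']

/-- **Lemma 1.** For `n = 2` outcomes and `d = m - 1 - α/(4(m-1))`, there is a constant
`f(m, α)` such that `Π^α_i(P; j) = 2(p_{[m],j} - d - 1)(p_{[m],j} - 2 p_{i,j} - d + 1) + f`. -/
theorem piAlpha_eq_product_form_two_outcomes (m : ℕ) (hm : 2 ≤ m) (α d : ℝ)
    (hd : d = (m : ℝ) - 1 - α / (4 * ((m : ℝ) - 1))) :
    ∃ f : ℝ, ∀ P : Fin m → Fin 2 → ℝ, IsSimplexTuple P → ∀ (i : Fin m) (j : Fin 2),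
      piAlpha α P i j =
        2 * ((∑ k, P k j) - d - 1) * ((∑ k, P k j) - 2 * P i j - d + 1) + f := by
  have hm' : (m : ℝ) - 1 ≠ 0 := by
    have : (2 : ℝ) ≤ m := by exact_mod_cast hm
    linarith
  refine ⟨1 + ((m : ℝ) - 1) ^ 2 - 2 * d ^ 2, fun P hP i j => ?_⟩
  rw [piAlpha, squ_two_outcomes (hP i).2, squ_two_outcomes (sum_avgExcept hm hP i),
    Fintype.sum_eq_add_sum_compl i, hd]
  simp only [avgExcept]
  field_simp
  ring
end

section
/- Let m ≥ 2, n = 2, α ∈ ℝ, set d = m − 1 − α/(4(m−1)), and let Π^α be the contract function Π^α_i(P; j) = s_qu(p_i; j) − (m−1)² s_qu(p̄_{−i}; j) + α p̄_{−i,j}. Fix a coalition C ⊆ [m] with |C| ≥ 2, an outcome j ∈ {1,2}, and fix the reports of all experts not in C. If d ≤ 0, then the coalition's total reward Σ_{i∈C} Π^α_i(P; j) is a strictly increasing function of p_{C,j}; if d > m − 1, it is a strictly decreasing function of p_{C,j}. (Formally: for P, Q ∈ (Δ_2)^m with p_i = q_i for all i ∉ C and p_{C,j} < q_{C,j}, if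 d ≤ 0 then Σ_{i∈C} Π^α_i(P; j) < Σ_{i∈C} Π^α_i(Q; j), and if d > m − 1 then Σ_{i∈C} Π^α_i(P; j) > Σ_{i∈C} Π^α_i(Q; j).) -/
open Finset

/-- With two outcomes, the quadratic score depends only on the probability of the outcome. -/
theorem squ_fin_two {p : Fin 2 → ℝ} (hp : p ∈ stdSimplex ℝ (Fin 2)) (j : Fin 2) :
    squ p j = 1 - 2 * (1 - p j) ^ 2 := by
  have h : p 0 + p 1 = 1 := by simpa [Fin.sum_univ_two] using hp.2
  have h0 : p 0 = 1 - p 1 := by linarith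
  have hc0 : ({0}ᶜ : Finset (Fin 2)) = {1} := by decide
  have hc1 : ({1}ᶜ : Finset (Fin 2)) = {0} := by decide
  fin_cases j
  · simp [squ, hc0, h0]; ring
  · simp [squ, hc1, h0]; ring

theorem avgExcept_eq {m n : ℕ} (P : Fin m → Fin n → ℝ) (i : Fin m) (j : Fin n) :
    avgExcept P i j = (∑ k, P k j - P i j) / ((m : ℝ) - 1) := by
  have h := Finset.sum_add_sum_compl {i} fun k => P k j
  rw [Finset.sum_singleton] at h
  rw [avgExcept, ← h]
  ring

theorem avgExcept_mem_stdSimplex {m n : ℕ} (hm : 2 ≤ m) {P : Fin m → Fin n → ℝ}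
    (hP : IsSimplexTuple P) (i : Fin m) : avgExcept P i ∈ stdSimplex ℝ (Fin n) := by
  have hm' : (0 : ℝ) < (m : ℝ) - 1 := by
    have : (2 : ℝ) ≤ m := by exact_mod_cast hm
    linarith
  refine ⟨fun j => mul_nonneg (by positivity) (Finset.sum_nonneg fun k _ => (hP k).1 j), ?_⟩
  simp only [avgExcept_eq]
  rw [← Finset.sum_div, Finset.sum_sub_distrib, Finset.sum_comm]
  simp only [(hP _).2]
  simp [hm'.ne']

/-- With two outcomes, the quadratic terms of the contract in the expert's own report cancel. -/
theorem piAlpha_fin_two {m : ℕ} (hm : 2 ≤ m) {α d : ℝ}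
    (hd : d = (m : ℝ) - 1 - α / (4 * ((m : ℝ) - 1))) {P : Fin m → Fin 2 → ℝ}
    (hP : IsSimplexTuple P) (i : Fin m) (j : Fin 2) :
    piAlpha α P i j = 1 - ((m : ℝ) - 1) ^ 2
      + 2 * (m - ∑ k, P k j) * (m - 2 - ∑ k, P k j + 2 * P i j)
      + 4 * (m - 1 - d) * (∑ k, P k j - P i j) := by
  have hm' : (m : ℝ) - 1 ≠ 0 := by
    have : (2 : ℝ) ≤ m := by exact_mod_cast hm
    linarith
  rw [piAlpha, squ_fin_two (hP i), squ_fin_two (avgExcept_mem_stdSimplex hm hP i),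
    avgExcept_eq, hd]
  field_simp
  ring

/-- With two outcomes, a coalition's total reward depends only on its total report and on the
total of all reports. -/
theorem sum_piAlpha_fin_two {m : ℕ} (hm : 2 ≤ m) {α d : ℝ}
    (hd : d = (m : ℝ) - 1 - α / (4 * ((m : ℝ) - 1))) (C : Finset (Fin m))
    {P : Fin m → Fin 2 → ℝ} (hP : IsSimplexTuple P) (j : Fin 2) :
    ∑ i ∈ C, piAlpha α P i j = C.card * (1 - ((m : ℝ) - 1) ^ 2)
      + 2 * (m - ∑ k, P k j) * (C.card * (m - 2 - ∑ k, P k j) + 2 * ∑ i ∈ C, P i j)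
      + 4 * (m - 1 - d) * (C.card * ∑ k, P k j - ∑ i ∈ C, P i j) := by
  simp only [piAlpha_fin_two hm hd hP]
  simp only [Finset.sum_add_distrib, ← Finset.mul_sum, Finset.sum_sub_distrib,
    Finset.sum_const, nsmul_eq_mul]
  ring

theorem IsSimplexTuple.sum_nonneg {m n : ℕ} {P : Fin m → Fin n → ℝ} (hP : IsSimplexTuple P)
    (C : Finset (Fin m)) (j : Fin n) : 0 ≤ ∑ i ∈ C, P i j :=
  Finset.sum_nonneg fun i _ => (hP i).1 j

theorem IsSimplexTuple.sum_le_card {m n : ℕ} {P : Fin m → Fin n → ℝ} (hP : IsSimplexTuple P)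
    (C : Finset (Fin m)) (j : Fin n) : ∑ i ∈ C, P i j ≤ C.card := by
  simpa using Finset.sum_le_card_nsmul C (fun i => P i j) 1 fun i _ =>
    (hP i).2 ▸ Finset.single_le_sum (fun l _ => (hP i).1 l) (Finset.mem_univ j)

/-- **Claim 1 (monotonicity).** For `n = 2` and `d = m - 1 - α/(4(m-1))`, with the reports
outside the coalition `C` held fixed: if `d ≤ 0` then the coalition's total reward under
outcome `j` is strictly increasing in `p_{C,j}`; if `d > m - 1` it is strictly decreasing. -/
theorem coalition_reward_monotone (m : ℕ) (hm : 2 ≤ m) (α d : ℝ)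
    (hd : d = (m : ℝ) - 1 - α / (4 * ((m : ℝ) - 1)))
    (C : Finset (Fin m)) (hC : 2 ≤ C.card) (j : Fin 2)
    (P Q : Fin m → Fin 2 → ℝ) (hP : IsSimplexTuple P) (hQ : IsSimplexTuple Q)
    (hout : ∀ i ∉ C, P i = Q i)
    (hlt : ∑ i ∈ C, P i j < ∑ i ∈ C, Q i j) :
    (d ≤ 0 → ∑ i ∈ C, piAlpha α P i j < ∑ i ∈ C, piAlpha α Q i j) ∧
    ((m : ℝ) - 1 < d → ∑ i ∈ C, piAlpha α Q i j < ∑ i ∈ C, piAlpha α P i j) := by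
  have hc : (2 : ℝ) ≤ C.card := by exact_mod_cast hC
  have hR : ∑ i ∈ Cᶜ, Q i j = ∑ i ∈ Cᶜ, P i j :=
    Finset.sum_congr rfl fun i hi => by rw [hout i (Finset.mem_compl.mp hi)]
  have hcard : ((Cᶜ.card : ℕ) : ℝ) = m - C.card := by
    have h := C.card_add_card_compl
    rw [Fintype.card_fin] at h
    exact eq_sub_of_add_eq' (by exact_mod_cast h)
  have hX0 := hP.sum_nonneg C j
  have hR0 := hP.sum_nonneg Cᶜ j
  have hX1 := hP.sum_le_card C j
  have hY1 := hQ.sum_le_card C j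
  have hR1 := hP.sum_le_card Cᶜ j
  rw [hcard] at hR1
  rw [sum_piAlpha_fin_two hm hd C hP, sum_piAlpha_fin_two hm hd C hQ,
    ← Finset.sum_add_sum_compl C fun k => P k j, ← Finset.sum_add_sum_compl C fun k => Q k j, hR]
  generalize (C.card : ℝ) = c at *
  generalize ∑ i ∈ C, P i j = x at *
  generalize ∑ i ∈ C, Q i j = y at *
  generalize ∑ i ∈ Cᶜ, P i j = r at *
  have hc1 : 0 < c - 1 := by linarith
  have hc2 : 0 ≤ c - 2 := by linarith
  constructor
  · intro hd0
    have hslope : 0 < (c - 2) * (x + y) / 2 + (c - 1) * r + 1 + (c - 1) * (-d) := by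
      have h1 : 0 ≤ (c - 2) * (x + y) := mul_nonneg hc2 (by linarith)
      have h2 : 0 ≤ (c - 1) * r := mul_nonneg hc1.le hR0
      have h3 : 0 ≤ (c - 1) * (-d) := mul_nonneg hc1.le (by linarith)
      linarith
    linear_combination 4 * mul_pos (sub_pos.mpr hlt) hslope
  · intro hd1
    have hslope : 0 < (c - 1) * d - ((c - 2) * (x + y) / 2 + (c - 1) * r + 1) := by
      have h1 : (c - 2) * (x + y) ≤ (c - 2) * (2 * c) :=
        mul_le_mul_of_nonneg_left (by linarith) hc2
      have h2 : (c - 1) * r ≤ (c - 1) * (m - c) := mul_le_mul_of_nonneg_left hR1 hc1.le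
      have h3 : (c - 1) * ((m : ℝ) - 1) < (c - 1) * d := mul_lt_mul_of_pos_left hd1 hc1
      linarith
    linear_combination 4 * mul_pos (sub_pos.mpr hlt) hslope
end

section
/- Let s : Δ_n × [n] → ℝ be any strictly proper scoring rule, and for m = 2 experts define the contract function Π(p_1, p_2; j) = (s(p_1; j) − s(p_2; j), s(p_2; j) − s(p_1; j)). Then Π is strictly proper and arbitrage-free. -/
open Finset

/-- A scoring rule `s : Δ_n × [n] → ℝ` is strictly proper if for every belief `b ∈ Δ_n`,
the expected score `∑ j, b j * s x j` is uniquely maximized over `x ∈ Δ_n` at `x = b`. -/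
def StrictlyProperScore {n : ℕ} (s : (Fin n → ℝ) → Fin n → ℝ) : Prop :=
  ∀ b ∈ stdSimplex ℝ (Fin n), ∀ x ∈ stdSimplex ℝ (Fin n), x ≠ b →
    ∑ j, b j * s x j < ∑ j, b j * s b j

/-- Under a strictly proper scoring rule, no report scores at least as well as another in every
outcome and strictly better in some outcome. -/
theorem StrictlyProperScore.not_dominated {n : ℕ} {s : (Fin n → ℝ) → Fin n → ℝ}
    (hs : StrictlyProperScore s) {p q : Fin n → ℝ} (hp : p ∈ stdSimplex ℝ (Fin n))
    (hq : q ∈ stdSimplex ℝ (Fin n)) (hle : ∀ j, s p j ≤ s q j) (hlt : ∃ j, s p j < s q j) :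
    False := by
  by_cases hqp : q = p
  · obtain ⟨j, hj⟩ := hlt
    exact (hqp ▸ hj).ne rfl
  · exact (hs p hp q hq hqp).not_ge
      (Finset.sum_le_sum fun j _ => mul_le_mul_of_nonneg_left (hle j) (hp.1 j))

/-- For `m = 2` experts and any strictly proper scoring rule `s`, the contract function
`Π(p₁, p₂; j) = (s(p₁; j) - s(p₂; j), s(p₂; j) - s(p₁; j))` is strictly proper and
arbitrage-free. -/
theorem two_expert_difference_contract (n : ℕ) (s : (Fin n → ℝ) → Fin n → ℝ)
    (hs : StrictlyProperScore s) :
    StrictlyProper (fun (P : Fin 2 → Fin n → ℝ) (i : Fin 2) (j : Fin n) =>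
        if i = 0 then s (P 0) j - s (P 1) j else s (P 1) j - s (P 0) j) ∧
      ArbitrageFree (fun (P : Fin 2 → Fin n → ℝ) (i : Fin 2) (j : Fin n) =>
        if i = 0 then s (P 0) j - s (P 1) j else s (P 1) j - s (P 0) j) := by
  constructor
  · intro i P _ b hb x hx hxb
    have h := hs b hb x hx hxb
    fin_cases i <;> simpa [mul_sub, Finset.sum_sub_distrib] using h
  · rintro ⟨C, P, Q, hP, hQ, hC, hle, hlt⟩
    have hstay : ∀ i ∉ C, s (P i) = s (Q i) := fun i hi => congrArg s (hC i hi)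
    by_cases h0 : (0 : Fin 2) ∈ C <;> by_cases h1 : (1 : Fin 2) ∈ C
    · have hCu : C = {0, 1} := by ext i; fin_cases i <;> simp [h0, h1]
      obtain ⟨j, hj⟩ := hlt
      simp [hCu] at hj
    · have hCu : C = {0} := by ext i; fin_cases i <;> simp [h0, h1]
      refine hs.not_dominated (hP 0) (hQ 0) ?_ ?_
      · simpa [hCu, hstay 1 h1] using hle
      · simpa [hCu, hstay 1 h1] using hlt
    · have hCu : C = {1} := by ext i; fin_cases i <;> simp [h0, h1]
      refine hs.not_dominated (hP 1) (hQ 1) ?_ ?_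
      · simpa [hCu, hstay 0 h0] using hle
      · simpa [hCu, hstay 0 h0] using hlt
    · have hCu : C = ∅ := by ext i; fin_cases i <;> simp [h0, h1]
      obtain ⟨j, hj⟩ := hlt
      simp [hCu] at hj
end

section
/- Let m ≥ 2, n ≥ 2, α ∈ ℝ, and set d = m − 1 − α/(2(m−1)). Then there exists a real constant f(m, n, α), depending only on m, n, and α, such that for all reports P ∈ (Δ_n)^m, all experts i ∈ [m], and all outcomes j ∈ [n]: s_qu(p_i; j) − (m−1)² s_qu(p̄_{−i}; j) + α p̄_{−i,j} = (p_{[m],j} − d − 1)(p_{[m],j} − 2p_{i,j} − d + 1) + Σ_{ℓ≠j} p_{[m],ℓ}(p_{[m],ℓ} − 2p_{i,ℓ}) + f(m, n, α), where p_{[m],ℓ} = Σ_{i∈[m]} p_{i,ℓ}. -/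
open Finset

/-- For general `n` and `d = m - 1 - α/(2(m-1))`, there is a constant `f(m, n, α)` with
`Π^α_i(P; j) = (p_{[m],j} - d - 1)(p_{[m],j} - 2 p_{i,j} - d + 1)
  + ∑_{l ≠ j} p_{[m],l} (p_{[m],l} - 2 p_{i,l}) + f`. -/
theorem piAlpha_eq_product_form (m n : ℕ) (hm : 2 ≤ m) (hn : 2 ≤ n) (α d : ℝ)
    (hd : d = (m : ℝ) - 1 - α / (2 * ((m : ℝ) - 1))) :
    ∃ f : ℝ, ∀ P : Fin m → Fin n → ℝ, IsSimplexTuple P → ∀ (i : Fin m) (j : Fin n),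
      piAlpha α P i j =
        ((∑ k, P k j) - d - 1) * ((∑ k, P k j) - 2 * P i j - d + 1)
          + (∑ l ∈ ({j}ᶜ : Finset (Fin n)), (∑ k, P k l) * ((∑ k, P k l) - 2 * P i l))
          + f := by
  have hN : (m : ℝ) - 1 ≠ 0 := by
    have : (2 : ℝ) ≤ m := by exact_mod_cast hm
    linarith
  refine ⟨1 - d ^ 2, fun P _ i j => ?_⟩
  have hsum (l : Fin n) : ∑ k, P k l = P i l + ∑ k ∈ ({i}ᶜ : Finset (Fin m)), P k l :=
    Fintype.sum_eq_add_sum_compl i _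
  have havg : ((m : ℝ) - 1) ^ 2 * ∑ l ∈ ({j}ᶜ : Finset (Fin n)), avgExcept P i l ^ 2
      = ∑ l ∈ ({j}ᶜ : Finset (Fin n)), (∑ k ∈ ({i}ᶜ : Finset (Fin m)), P k l) ^ 2 := by
    rw [Finset.mul_sum]
    refine Finset.sum_congr rfl fun l _ => ?_
    rw [avgExcept]
    field_simp
  have hcross : ∑ l ∈ ({j}ᶜ : Finset (Fin n)), (∑ k, P k l) * ((∑ k, P k l) - 2 * P i l)
      = ∑ l ∈ ({j}ᶜ : Finset (Fin n)), (∑ k ∈ ({i}ᶜ : Finset (Fin m)), P k l) ^ 2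
        - ∑ l ∈ ({j}ᶜ : Finset (Fin n)), P i l ^ 2 := by
    rw [← Finset.sum_sub_distrib]
    refine Finset.sum_congr rfl fun l _ => ?_
    rw [hsum]
    ring
  rw [hcross, ← havg, hsum, piAlpha, squ, squ, hd]
  have hj : ∑ k ∈ ({i}ᶜ : Finset (Fin m)), P k j = ((m : ℝ) - 1) * avgExcept P i j := by
    rw [avgExcept]
    field_simp
  rw [hj]
  field_simp
  ring
end

section
/- Let m > 2, n = 2, and let α be a real number with α < 0 or α ≥ 4(m−1)², and let Π^α be the contract function Π^α_i(P; j) = s_qu(p_i; j) − (m−1)² s_qu(p̄_{−i}; j) + α p̄_{−i,j}. Then Π^α admits expected arbitrage. Specifically, take the coalition C = [m], beliefs p_i = (1/2, 1/2) for all i, and deviation q_i = (1, 0) for all i: under truthful reports P each expert's reward is α/2 + (1 − (m−1)²)/2 under both outcomes, while under the deviation Q each expert's expected total coalition reward (with respect to the belief (1/2, 1/2)) strictly increases. -/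
open Finset

/-- `Φ` admits expected arbitrage: a coalition `C` can deviate so that, in the opinion of
every expert in `C`, the expected total reward of `C` does not decrease, and strictly
increases in the opinion of some expert in `C`. -/
def AdmitsExpectedArbitrage {m n : ℕ}
    (Φ : (Fin m → Fin n → ℝ) → Fin m → Fin n → ℝ) : Prop :=
  ∃ (C : Finset (Fin m)) (P Q : Fin m → Fin n → ℝ), IsSimplexTuple P ∧ IsSimplexTuple Q ∧
    (∀ i ∉ C, P i = Q i) ∧
    (∀ i ∈ C, ∑ j, P i j * ∑ k ∈ C, Φ P k j ≤ ∑ j, P i j * ∑ k ∈ C, Φ Q k j) ∧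
    (∃ i ∈ C, ∑ j, P i j * ∑ k ∈ C, Φ P k j < ∑ j, P i j * ∑ k ∈ C, Φ Q k j)

/-- The average of the other reports is the common report when all experts agree. -/
theorem avgExcept_const {m n : ℕ} (hm : 1 < m) (p : Fin n → ℝ) (i : Fin m) :
    avgExcept (fun _ => p) i = p := by
  have hm' : (m : ℝ) - 1 ≠ 0 := by
    have : (1 : ℝ) < m := by exact_mod_cast hm
    linarith
  funext j
  simp only [avgExcept, sum_const, card_compl, Fintype.card_fin, card_singleton, nsmul_eq_mul]
  rw [Nat.cast_sub hm.le, Nat.cast_one]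
  field_simp

theorem piAlpha_const {m n : ℕ} (hm : 1 < m) (α : ℝ) (p : Fin n → ℝ) (i : Fin m) (j : Fin n) :
    piAlpha α (fun _ => p) i j = (1 - ((m : ℝ) - 1) ^ 2) * squ p j + α * p j := by
  rw [piAlpha, avgExcept_const hm]
  ring

theorem squ_fin_two_zero (p : Fin 2 → ℝ) : squ p 0 = 1 - (1 - p 0) ^ 2 - p 1 ^ 2 := by
  have h : ({0}ᶜ : Finset (Fin 2)) = {1} := by decide
  simp [squ, h]

theorem squ_fin_two_one (p : Fin 2 → ℝ) : squ p 1 = 1 - (1 - p 1) ^ 2 - p 0 ^ 2 := by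
  have h : ({1}ᶜ : Finset (Fin 2)) = {0} := by decide
  simp [squ, h]

/-- For `m > 2` experts, two outcomes, and `α < 0` or `α ≥ 4(m-1)²`, the contract function
`Π^α` admits expected arbitrage: with the coalition of all experts, truthful reports all
equal to `(1/2, 1/2)` (each expert then gets `α/2 + (1 - (m-1)²)/2` under both outcomes),
the deviation to all reporting `(1, 0)` strictly increases every expert's expected total
coalition reward. -/
theorem piAlpha_admits_expected_arbitrage (m : ℕ) (hm : 2 < m) (α : ℝ)
    (hα : α < 0 ∨ 4 * ((m : ℝ) - 1) ^ 2 ≤ α) :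
    (∀ (i : Fin m) (j : Fin 2),
        piAlpha α (fun _ _ => (1 / 2 : ℝ)) i j = α / 2 + (1 - ((m : ℝ) - 1) ^ 2) / 2) ∧
    (∀ i : Fin m,
        ∑ j : Fin 2, (1 / 2 : ℝ) *
            ∑ k : Fin m, piAlpha α (fun (_ : Fin m) (_ : Fin 2) => (1 / 2 : ℝ)) k j <
          ∑ j : Fin 2, (1 / 2 : ℝ) *
            ∑ k : Fin m,
              piAlpha α (fun (_ : Fin m) (j' : Fin 2) => if j' = 0 then (1 : ℝ) else 0) k j) ∧
    AdmitsExpectedArbitrage (piAlpha (m := m) (n := 2) α) := by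
  have hm1 : 1 < m := by omega
  have hm2 : (2 : ℝ) < m := by exact_mod_cast hm
  have gain : ∑ j : Fin 2, (1 / 2 : ℝ) *
        ∑ k : Fin m, piAlpha α (fun (_ : Fin m) (_ : Fin 2) => (1 / 2 : ℝ)) k j <
      ∑ j : Fin 2, (1 / 2 : ℝ) *
        ∑ k : Fin m,
          piAlpha α (fun (_ : Fin m) (j' : Fin 2) => if j' = 0 then (1 : ℝ) else 0) k j := by
    simp only [piAlpha_const hm1, Fin.sum_univ_two, squ_fin_two_zero, squ_fin_two_one, sum_const,
      card_univ, Fintype.card_fin, nsmul_eq_mul, if_true, one_ne_zero, if_false]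
    have h : 0 < (m : ℝ) * (((m : ℝ) - 1) ^ 2 - 1) :=
      mul_pos (by linarith) (by nlinarith)
    linarith
  refine ⟨fun i j => ?_, fun _ => gain, univ, fun _ _ => 1 / 2,
    fun _ j => if j = 0 then 1 else 0, fun _ => ⟨fun _ => by norm_num, by norm_num⟩,
    fun _ => ⟨fun j => ?_, by simp⟩, fun i hi => absurd (mem_univ i) hi,
    fun _ _ => gain.le, ⟨0, by omega⟩, mem_univ _, gain⟩
  · rw [piAlpha_const hm1]
    fin_cases j
    · simp only [Fin.zero_eta, squ_fin_two_zero]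
      ring
    · simp only [Fin.mk_one, squ_fin_two_one]
      ring
  · dsimp only
    split_ifs <;> norm_num
end
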